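/- Suppose (V,b) ≈ (V',b') are nonsingular finite-dimensional metric spaces over F. Let E, A ⊆ V and E', A' ⊆ V' be subspaces such that E ⊆ A^⊥, E' ⊆ A'^⊥, E ≈ E', A ≈ A', and dim(E ∩ A) = dim(E' ∩ A'). Then there exists an isometry φ_V : V → V' such that φ_V(E) = E' and φ_V(A) = A'. -/

import Mathlib

open Module

namespace Witt

variable {F V V' : Type*} [Field F] [AddCommGroup V] [Module F V]
  [AddCommGroup V'] [Module F V']

/-- A linear equivalence `φ : E ≃ E'` between subspaces is an isometry if it
preserves the ambient bilinear forms. -/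
def IsIsometryOn (B : LinearMap.BilinForm F V) (B' : LinearMap.BilinForm F V')
    (E : Submodule F V) (E' : Submodule F V') (φ : E ≃ₗ[F] E') : Prop :=
  ∀ u v : E, B' (φ u : V') (φ v : V') = B (u : V) (v : V)

/-- A linear equivalence of the whole spaces which preserves the forms. -/
def IsIsometry (B : LinearMap.BilinForm F V) (B' : LinearMap.BilinForm F V')
    (ψ : V ≃ₗ[F] V') : Prop :=
  ∀ u v : V, B' (ψ u) (ψ v) = B u v

/-- The two metric spaces `(V,B)` and `(V',B')` are isometric. -/
def AreIsometric (B : LinearMap.BilinForm F V) (B' : LinearMap.BilinForm F V') : Prop :=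
  ∃ ψ : V ≃ₗ[F] V', IsIsometry B B' ψ

/-- The subspaces `N ⊆ V` and `N' ⊆ V'` are isometric with respect to the
restrictions of the ambient forms. -/
def SubIsometric (B : LinearMap.BilinForm F V) (B' : LinearMap.BilinForm F V')
    (N : Submodule F V) (N' : Submodule F V') : Prop :=
  ∃ ψ : N ≃ₗ[F] N', IsIsometryOn B B' N N' ψ

/-- A subspace is totally isotropic. -/
def TotIsotropic (B : LinearMap.BilinForm F V) (N : Submodule F V) : Prop :=
  ∀ u ∈ N, ∀ v ∈ N, B u v = 0

end Witt

open Module Witt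

namespace Witt

section Extension

variable {F V V' : Type*} [Field F] [AddCommGroup V] [Module F V]
  [AddCommGroup V'] [Module F V'] [FiniteDimensional F V]

/-- A form-preserving endomorphism of a nondegenerate space is an isometry of the space. -/
lemma exists_isometry_of_preserves {B : LinearMap.BilinForm F V} (hnd : B.Nondegenerate)
    (g : V →ₗ[F] V) (hg : ∀ u v, B (g u) (g v) = B u v) :
    ∃ ψ : V ≃ₗ[F] V, IsIsometry B B ψ ∧ ∀ v, ψ v = g v := by
  have hinj : Function.Injective g := by
    rw [← LinearMap.ker_eq_bot, LinearMap.ker_eq_bot']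
    intro m hm
    exact hnd.1 m fun n => by rw [← hg, hm, map_zero, LinearMap.zero_apply]
  exact ⟨LinearEquiv.ofInjectiveEndo g hinj, hg, fun _ => rfl⟩

/-- A vector outside a subspace `H` is separated from `H` by a vector orthogonal to `H`. -/
lemma exists_orthogonal_apply_eq_one {B : LinearMap.BilinForm F V} (hnd : B.Nondegenerate)
    {H : Submodule F V} {x : V} (hx : x ∉ H) :
    ∃ v, (∀ h ∈ H, B v h = 0) ∧ B v x = 1 := by
  obtain ⟨f, hf, hfx⟩ := LinearMap.exists_extend_of_notMem (0 : H →ₗ[F] F) hx 1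
  refine ⟨(B.toDual hnd).symm f, fun h hh => ?_, ?_⟩
  · rw [LinearMap.BilinForm.apply_toDual_symm_apply]
    simpa using congr($hf ⟨h, hh⟩)
  · rw [LinearMap.BilinForm.apply_toDual_symm_apply, hfx]

/-- If `x` and `y` lie outside `H` and have the same products with `H` and with themselves,
then some isometry fixes `H` pointwise and sends `x` to `y`. -/
lemma exists_isometry_fixing {B : LinearMap.BilinForm F V} (hchar : (2 : F) ≠ 0)
    (hB : ∀ u v, B u v = B v u) (hnd : B.Nondegenerate) {H : Submodule F V} {x y : V}
    (hx : x ∉ H) (hy : y ∉ H) (hxy : ∀ h ∈ H, B x h = B y h) (hq : B x x = B y y) :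
    ∃ ψ : V ≃ₗ[F] V, IsIsometry B B ψ ∧ (∀ h ∈ H, ψ h = h) ∧ ψ x = y := by
  suffices h : ∃ g : V →ₗ[F] V, (∀ u v, B (g u) (g v) = B u v) ∧ (∀ h ∈ H, g h = h) ∧ g x = y by
    obtain ⟨g, hg, hgH, hgx⟩ := h
    obtain ⟨ψ, hψ, hψg⟩ := exists_isometry_of_preserves hnd g hg
    exact ⟨ψ, hψ, fun h hh => (hψg h).trans (hgH h hh), (hψg x).trans hgx⟩
  obtain ⟨w, rfl⟩ : ∃ w, y = x - w := ⟨x - y, by abel⟩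
  have hwH : ∀ h ∈ H, B w h = 0 := fun h hh => by
    have := hxy h hh
    simp only [map_sub, LinearMap.sub_apply] at this
    linear_combination this
  have hww : B w w = 2 * B x w := by
    simp only [map_sub, LinearMap.sub_apply] at hq
    rw [hB w x] at hq
    linear_combination -hq
  by_cases hw : B w w = 0
  · have hwx : B w x = 0 := by
      rw [hw] at hww
      rw [hB w x]
      exact (mul_eq_zero.mp hww.symm).resolve_left hchar
    by_cases hxs : x ∈ H ⊔ F ∙ w
    · obtain ⟨h, hh, z, hz, rfl⟩ := Submodule.mem_sup.mp hxs
      obtain ⟨c, rfl⟩ := Submodule.mem_span_singleton.mp hz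
      have hwn : w ∉ H := fun hwn => hx (H.add_mem hh (H.smul_mem c hwn))
      have hc : c ≠ 0 := by
        rintro rfl
        exact hx (by simpa using hh)
      have hc1 : c - 1 ≠ 0 := by
        intro hc1
        obtain rfl : c = 1 := by linear_combination hc1
        exact hy (by simpa using hh)
      obtain ⟨v, hvH, hvw⟩ := exists_orthogonal_apply_eq_one hnd hwn
      have hwv : B w v = 1 := by rw [hB, hvw]
      obtain ⟨u, hu⟩ : ∃ u, u = v - (B v v / 2) • w := ⟨_, rfl⟩
      have huH : ∀ h ∈ H, B u h = 0 := fun h hh => by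
        simp [hu, hvH h hh, hwH h hh]
      have huw : B u w = 1 := by simp [hu, hvw, hw]
      have huu : B u u = 0 := by
        simp only [hu, map_sub, map_smul, LinearMap.sub_apply, LinearMap.smul_apply, smul_eq_mul,
          hvw, hwv, hw]
        field_simp
        ring
      have hwu : B w u = 1 := by rw [hB, huw]
      refine ⟨LinearMap.id + (-c⁻¹) • (B u).smulRight w + (c / (c - 1) - 1) • (B w).smulRight u,
        fun s t => ?_, fun k hk => ?_, ?_⟩
      · simp only [LinearMap.add_apply, LinearMap.id_apply, LinearMap.smul_apply,
          LinearMap.smulRight_apply, map_add, map_smul, smul_eq_mul, hw, huu, huw, hwu,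
          hB s u, hB s w]
        field_simp
        ring
      · simp [huH k hk, hwH k hk]
      · simp only [LinearMap.add_apply, LinearMap.id_apply, LinearMap.smul_apply,
          LinearMap.smulRight_apply, map_add, map_smul, hw, huw, huH h hh,
          hwH h hh]
        match_scalars <;> field_simp <;> ring
    · obtain ⟨v, hvs, hvx⟩ := exists_orthogonal_apply_eq_one hnd hxs
      have hvH : ∀ h ∈ H, B v h = 0 := fun h hh => hvs h (Submodule.mem_sup_left hh)
      have hvw : B v w = 0 :=
        hvs w (Submodule.mem_sup_right (Submodule.mem_span_singleton_self w))
      have hwv : B w v = 0 := by rw [hB, hvw]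
      refine ⟨LinearMap.id + (B w).smulRight v - (B v).smulRight w
        - (B v v / 2) • (B w).smulRight w, fun s t => ?_, fun k hk => ?_, ?_⟩
      · simp only [LinearMap.add_apply, LinearMap.sub_apply, LinearMap.id_apply,
          LinearMap.smul_apply, LinearMap.smulRight_apply, map_add, map_sub, map_smul,
          smul_eq_mul, hw, hvw, hwv, hB s v, hB s w]
        field_simp
        ring
      · simp [hvH k hk, hwH k hk]
      · simp [hwx, hvx]
  · refine ⟨LinearMap.id - (2 / B w w) • (B w).smulRight w, fun s t => ?_, fun k hk => ?_, ?_⟩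
    · simp only [LinearMap.sub_apply, LinearMap.id_apply,
        LinearMap.smul_apply, LinearMap.smulRight_apply, map_sub, map_smul,
        smul_eq_mul, hB s w]
      field_simp
      ring
    · simp [hwH k hk]
    · have : 2 / B w w * B w x = 1 := by
        rw [div_mul_eq_mul_div, hB w x, ← hww, div_self hw]
      simp [smul_smul, this]

/-- **Witt's extension theorem** within one space: a linear map which is isometric and injective
on a subspace agrees there with an isometry of the whole space. -/
theorem exists_isometry_eqOn {B : LinearMap.BilinForm F V} (hchar : (2 : F) ≠ 0)
    (hB : ∀ u v, B u v = B v u) (hnd : B.Nondegenerate) (f : V →ₗ[F] V) (U : Submodule F V)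
    (hf : ∀ u ∈ U, ∀ v ∈ U, B (f u) (f v) = B u v) (hf0 : ∀ u ∈ U, f u = 0 → u = 0) :
    ∃ ψ : V ≃ₗ[F] V, IsIsometry B B ψ ∧ ∀ u ∈ U, ψ u = f u := by
  classical
  obtain ⟨s, rfl⟩ := IsNoetherian.noetherian U
  induction s using Finset.induction_on with
  | empty =>
    refine ⟨LinearEquiv.refl F V, fun _ _ => rfl, fun u hu => ?_⟩
    obtain rfl : u = 0 := by simpa using hu
    simp
  | insert x s _ ih =>
    have hle : Submodule.span F (s : Set V) ≤ Submodule.span F (insert x s : Finset V) :=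
      Submodule.span_mono (by simp)
    have hxm : x ∈ Submodule.span F ((insert x s : Finset V) : Set V) :=
      Submodule.subset_span (by simp)
    obtain ⟨ψ, hψ, hψf⟩ := ih (fun u hu v hv => hf u (hle hu) v (hle hv))
      (fun u hu => hf0 u (hle hu))
    by_cases hx : x ∈ Submodule.span F (s : Set V)
    · refine ⟨ψ, hψ, fun u hu => hψf u ?_⟩
      rwa [Finset.coe_insert, Submodule.span_insert_eq_span hx] at hu
    have hy : ψ.symm (f x) ∉ Submodule.span F (s : Set V) := fun hy => by
      have h := hψf _ hy
      rw [LinearEquiv.apply_symm_apply] at h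
      have h0 := hf0 (x - ψ.symm (f x)) (Submodule.sub_mem _ hxm (hle hy))
        (by rw [map_sub, ← h, sub_self])
      exact hx (by rwa [sub_eq_zero.mp h0])
    obtain ⟨χ, hχ, hχs, hχx⟩ := exists_isometry_fixing hchar hB hnd hx hy
      (fun h hh => by
        rw [← hψ (ψ.symm (f x)), LinearEquiv.apply_symm_apply, hψf h hh, hf x hxm h (hle hh)])
      (by rw [← hψ (ψ.symm (f x)), LinearEquiv.apply_symm_apply, hf x hxm x hxm])
    refine ⟨χ.trans ψ, fun u v => by simp [hψ _ _, hχ _ _], fun u hu => ?_⟩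
    rw [Finset.coe_insert, Submodule.mem_span_insert] at hu
    obtain ⟨a, z, hz, rfl⟩ := hu
    simp [hχx, hχs z hz, hψf z hz]

/-- **Witt's extension theorem** between two isometric spaces. -/
theorem exists_isometry_eqOn_of_areIsometric {B : LinearMap.BilinForm F V}
    {B' : LinearMap.BilinForm F V'} (hchar : (2 : F) ≠ 0)
    (hB : ∀ u v, B u v = B v u) (hnd : B.Nondegenerate) (hVV' : AreIsometric B B')
    (f : V →ₗ[F] V') (U : Submodule F V)
    (hf : ∀ u ∈ U, ∀ v ∈ U, B' (f u) (f v) = B u v) (hf0 : ∀ u ∈ U, f u = 0 → u = 0) :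
    ∃ ψ : V ≃ₗ[F] V', IsIsometry B B' ψ ∧ ∀ u ∈ U, ψ u = f u := by
  obtain ⟨η, hη⟩ := hVV'
  obtain ⟨ψ, hψ, hψf⟩ := exists_isometry_eqOn hchar hB hnd (η.symm.toLinearMap ∘ₗ f) U
    (fun u hu v hv => by rw [← hη]; simp [hf u hu v hv])
    (fun u hu h => hf0 u hu (by simpa using h))
  exact ⟨ψ.trans η, fun u v => by simp [hη _ _, hψ _ _], fun u hu => by simp [hψf u hu]⟩

end Extension

section Radical

variable {F M : Type*} [Field F] [AddCommGroup M] [Module F M] [FiniteDimensional F M]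

/-- A linear equivalence between subspaces of `K` extends to an automorphism of the whole space
which is the identity modulo `K`. -/
lemma exists_linearEquiv_extending_sub_mem {K D D' : Submodule F M} (hD : D ≤ K) (hD' : D' ≤ K)
    (δ : D ≃ₗ[F] D') :
    ∃ θ : M ≃ₗ[F] M, (∀ d : D, θ d = δ d) ∧ ∀ m, θ m - m ∈ K := by
  obtain ⟨ρ, hρ⟩ := Submodule.exists_linearEquiv_restrict_eq
    ((Submodule.comapSubtypeEquivOfLe hD).trans
      (δ.trans (Submodule.comapSubtypeEquivOfLe hD').symm))
  obtain ⟨p, hp⟩ := K.subtype.exists_leftInverse_of_injective K.ker_subtype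
  have hpK : ∀ k : K, p k = k := fun k => congr($hp k)
  let g : M →ₗ[F] M := LinearMap.id + K.subtype ∘ₗ (ρ.toLinearMap ∘ₗ p - p)
  have hg : ∀ m, g m = m + ((ρ (p m) : M) - p m) := fun m => by simp [g]
  have hinj : Function.Injective g := by
    rw [← LinearMap.ker_eq_bot, LinearMap.ker_eq_bot']
    intro m hm
    have hpg : p (g m) = ρ (p m) := by rw [hg, map_add, map_sub, hpK, hpK]; abel
    have hpm : p m = 0 := by
      rwa [hm, map_zero, eq_comm, LinearEquiv.map_eq_zero_iff] at hpg
    simpa [hg, hpm] using hm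
  refine ⟨LinearEquiv.ofInjectiveEndo g hinj, fun d => ?_, fun m => ?_⟩
  · have h1 : p d = ⟨d, hD d.2⟩ := hpK ⟨d, hD d.2⟩
    have h2 := congr(((($(hρ ⟨⟨d, hD d.2⟩, d.2⟩)) : K) : M))
    change ((δ d : D') : M) = _ at h2
    rw [LinearEquiv.coe_ofInjectiveEndo, hg, h1, h2]
    simp
  · rw [LinearEquiv.coe_ofInjectiveEndo, hg, add_sub_cancel_left]
    exact K.sub_mem (ρ (p m)).2 (p m).2

end Radical

section Gluing

variable {F V V' : Type*} [Field F] [AddCommGroup V] [Module F V]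
  [AddCommGroup V'] [Module F V'] [FiniteDimensional F V]

/-- Isometric subspaces admit an isometry extending any prescribed linear equivalence between
subspaces of their radicals. -/
lemma SubIsometric.exists_isometryOn_extending {B : LinearMap.BilinForm F V}
    {B' : LinearMap.BilinForm F V'} (hB : ∀ u v, B u v = B v u)
    {E D : Submodule F V} {E' D' : Submodule F V'} (h : SubIsometric B B' E E')
    (hDE : D ≤ E) (hDE' : D' ≤ E') (hD : ∀ d ∈ D, ∀ e ∈ E, B d e = 0)
    (hD' : ∀ d ∈ D', ∀ e ∈ E', B' d e = 0) (δ : D ≃ₗ[F] D') :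
    ∃ φ : E ≃ₗ[F] E', IsIsometryOn B B' E E' φ ∧
      ∀ (d : V) (hd : d ∈ D), (φ ⟨d, hDE hd⟩ : V') = δ ⟨d, hd⟩ := by
  obtain ⟨φ, hφ⟩ := h
  let K : Submodule F E := LinearMap.ker (B.restrict E)
  have hK : ∀ k ∈ K, ∀ e : E, B (k : V) e = 0 := fun k hk e => congr($hk e)
  let D₁ : Submodule F E := D.comap E.subtype
  let D₂ : Submodule F E := (D'.comap E'.subtype).map φ.symm.toLinearMap
  have hD₁ : D₁ ≤ K := fun d hd => by
    ext e
    exact hD d hd e e.2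
  have hD₂ : D₂ ≤ K := by
    rintro _ ⟨d, hd, rfl⟩
    ext e
    change B (φ.symm d : V) e = 0
    rw [← hφ, LinearEquiv.apply_symm_apply]
    exact hD' d hd _ (φ e).2
  obtain ⟨θ, hθ, hθK⟩ := exists_linearEquiv_extending_sub_mem hD₁ hD₂
    ((Submodule.comapSubtypeEquivOfLe hDE).trans (δ.trans
      ((Submodule.comapSubtypeEquivOfLe hDE').symm.trans (φ.symm.submoduleMap _))))
  refine ⟨θ.trans φ, fun u v => ?_, fun d hd => ?_⟩
  · have hu : B (θ u : V) (θ v) = B (u : V) (θ v) := by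
      have := hK _ (hθK u) (θ v)
      rw [Submodule.coe_sub, map_sub, LinearMap.sub_apply] at this
      exact sub_eq_zero.mp this
    have hv : B (θ v : V) u = B (v : V) u := by
      have := hK _ (hθK v) u
      rw [Submodule.coe_sub, map_sub, LinearMap.sub_apply] at this
      exact sub_eq_zero.mp this
    rw [LinearEquiv.trans_apply, LinearEquiv.trans_apply, hφ, hu, hB, hv, hB]
  · have h1 : θ ⟨d, hDE hd⟩ = φ.symm ⟨δ ⟨d, hd⟩, hDE' (δ ⟨d, hd⟩).2⟩ :=
      hθ ⟨⟨d, hDE hd⟩, hd⟩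
    rw [LinearEquiv.trans_apply, h1, LinearEquiv.apply_symm_apply]

end Gluing

/-- Linear maps on two subspaces which agree on their intersection extend to a common linear map
on the whole space. -/
lemma exists_linearMap_extending_pair {F V V' : Type*} [Field F] [AddCommGroup V] [Module F V]
    [AddCommGroup V'] [Module F V'] {E A : Submodule F V} (f : E →ₗ[F] V') (g : A →ₗ[F] V')
    (hfg : ∀ (e : E) (a : A), (e : V) = a → f e = g a) :
    ∃ k : V →ₗ[F] V', (∀ e : E, k e = f e) ∧ ∀ a : A, k a = g a := by
  let p : V →ₗ.[F] V' := ⟨E, f⟩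
  let q : V →ₗ.[F] V' := ⟨A, g⟩
  obtain ⟨k, hk⟩ := (p.sup q hfg).toFun.exists_extend
  refine ⟨k, fun e => ?_, fun a => ?_⟩
  · exact congr($hk ⟨e, Submodule.mem_sup_left e.2⟩).trans
      ((p.left_le_sup q hfg).2 (x := e) rfl).symm
  · exact congr($hk ⟨a, Submodule.mem_sup_right a.2⟩).trans
      ((p.right_le_sup q hfg).2 (x := a) rfl).symm

/-- A linear equivalence extending an equivalence between subspaces maps one onto the other. -/
lemma map_eq_of_forall_apply_eq {F V V' : Type*} [Field F] [AddCommGroup V] [Module F V]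
    [AddCommGroup V'] [Module F V'] {E : Submodule F V} {E' : Submodule F V'}
    (φ : E ≃ₗ[F] E') (ψ : V →ₗ[F] V') (h : ∀ e : E, ψ e = φ e) : E.map ψ = E' := by
  ext v
  constructor
  · rintro ⟨e, he, rfl⟩
    rw [h ⟨e, he⟩]
    exact (φ ⟨e, he⟩).2
  · intro hv
    refine ⟨φ.symm ⟨v, hv⟩, (φ.symm ⟨v, hv⟩).2, ?_⟩
    rw [h, LinearEquiv.apply_symm_apply]

end Witt

/-- Corollary 2.6: if `E ⊥ A`, `E' ⊥ A'`, `E ≈ E'`, `A ≈ A'`, and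
`dim(E ∩ A) = dim(E' ∩ A')`, then there exists an isometry `φ_V : V → V'`
with `φ_V(E) = E'` and `φ_V(A) = A'`. -/
theorem witt_exists_isometry_perp_pair {F V V' : Type*} [Field F]
    [AddCommGroup V] [Module F V] [AddCommGroup V'] [Module F V']
    [FiniteDimensional F V] [FiniteDimensional F V']
    (hchar : (2 : F) ≠ 0)
    (B : LinearMap.BilinForm F V) (B' : LinearMap.BilinForm F V')
    (hB : ∀ u v : V, B u v = B v u) (hB' : ∀ u v : V', B' u v = B' v u)
    (hnd : B.Nondegenerate) (hnd' : B'.Nondegenerate)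
    (hVV' : AreIsometric B B')
    (E A : Submodule F V) (E' A' : Submodule F V')
    (hEA : E ≤ B.orthogonal A) (hEA' : E' ≤ B'.orthogonal A')
    (hEE' : SubIsometric B B' E E') (hAA' : SubIsometric B B' A A')
    (hdim : finrank F ↥(E ⊓ A) = finrank F ↥(E' ⊓ A')) :
    ∃ φV : V ≃ₗ[F] V', IsIsometry B B' φV ∧
      E.map φV.toLinearMap = E' ∧ A.map φV.toLinearMap = A' := by
  have hAE : ∀ a ∈ A, ∀ e ∈ E, B a e = 0 := fun a ha e he => hEA he a ha
  have hAE' : ∀ a ∈ A', ∀ e ∈ E', B' a e = 0 := fun a ha e he => hEA' he a ha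
  let δ : ↥(E ⊓ A) ≃ₗ[F] ↥(E' ⊓ A') := LinearEquiv.ofFinrankEq _ _ hdim
  obtain ⟨φ, hφ, hφδ⟩ := hEE'.exists_isometryOn_extending hB inf_le_left inf_le_left
    (fun d hd => hAE d hd.2) (fun d hd => hAE' d hd.2) δ
  obtain ⟨χ, hχ, hχδ⟩ := hAA'.exists_isometryOn_extending hB inf_le_right inf_le_right
    (fun d hd a ha => by rw [hB, hAE a ha d hd.1])
    (fun d hd a ha => by rw [hB', hAE' a ha d hd.1]) δ
  obtain ⟨k, hkE, hkA⟩ := exists_linearMap_extending_pair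
    (E'.subtype ∘ₗ φ.toLinearMap) (A'.subtype ∘ₗ χ.toLinearMap) (by
      rintro ⟨e, he⟩ ⟨a, ha⟩ rfl
      exact (hφδ e ⟨he, ha⟩).trans (hχδ e ⟨he, ha⟩).symm)
  replace hkE : ∀ e : E, k e = φ e := hkE
  replace hkA : ∀ a : A, k a = χ a := hkA
  obtain ⟨ψ, hψ, hψk⟩ := exists_isometry_eqOn_of_areIsometric hchar hB hnd hVV' k (E ⊔ A)
    (by
      intro u hu v hv
      obtain ⟨e, he, a, ha, rfl⟩ := Submodule.mem_sup.mp hu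
      obtain ⟨e₁, he₁, a₁, ha₁, rfl⟩ := Submodule.mem_sup.mp hv
      have hc : B' (χ ⟨a, ha⟩) (φ ⟨e₁, he₁⟩) = 0 := hAE' _ (χ _).2 _ (φ _).2
      have hc₁ : B' (φ ⟨e, he⟩) (χ ⟨a₁, ha₁⟩) = 0 := by
        rw [hB']
        exact hAE' _ (χ _).2 _ (φ _).2
      have hd₁ : B e a₁ = 0 := by rw [hB, hAE a₁ ha₁ e he]
      simp only [map_add, LinearMap.add_apply, hkE ⟨e, he⟩, hkE ⟨e₁, he₁⟩, hkA ⟨a, ha⟩,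
        hkA ⟨a₁, ha₁⟩, hφ ⟨e, he⟩ ⟨e₁, he₁⟩, hχ ⟨a, ha⟩ ⟨a₁, ha₁⟩, hc, hc₁, hd₁,
        hAE a ha e₁ he₁])
    (by
      intro u hu h0
      obtain ⟨e, he, a, ha, rfl⟩ := Submodule.mem_sup.mp hu
      rw [map_add, hkE ⟨e, he⟩, hkA ⟨a, ha⟩] at h0
      have hmem : (φ ⟨e, he⟩ : V') ∈ E' ⊓ A' := by
        refine ⟨(φ _).2, ?_⟩
        rw [eq_neg_of_add_eq_zero_left h0]
        exact A'.neg_mem (χ _).2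
      obtain ⟨⟨d, hd⟩, hdδ⟩ := δ.surjective ⟨_, hmem⟩
      have hde : (φ ⟨d, hd.1⟩ : V') = φ ⟨e, he⟩ := by rw [hφδ d hd, hdδ]
      obtain rfl : d = e := congr_arg Subtype.val (φ.injective (Subtype.ext hde))
      rw [hφδ d hd, ← hχδ d hd, ← Submodule.coe_add, ← map_add, ZeroMemClass.coe_eq_zero,
        LinearEquiv.map_eq_zero_iff] at h0
      exact congr_arg Subtype.val h0)
  exact ⟨ψ, hψ,
    map_eq_of_forall_apply_eq φ _ fun e =>
      (hψk e (Submodule.mem_sup_left e.2)).trans (hkE e),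
    map_eq_of_forall_apply_eq χ _ fun a =>
      (hψk a (Submodule.mem_sup_right a.2)).trans (hkA a)⟩
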